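/- arXiv:1609.05573 — 2 statements merged into one kernel-verified Lean document; each statement's English description precedes it below -/
import Mathlib

section
/- Let G be a finite group of order L ≥ 3 and let ᾱ be the L×L matrix (indexed by G×G) with all entries 1/L². For nonnegative matrices α : G×G → ℝ whose row sums and column sums all equal 1/L (i.e., Σ_b α_{ab} = 1/L for each a and Σ_a α_{ab} = 1/L for each b), define α_h = Σ_{(a,b) : a⁻¹b = h} α_{ab} for h ∈ G, and D(α, ᾱ) = Σ_{a,b} α_{ab}·log(L²·α_{ab}) (the KL divergence). Then sup over all such α with α ≠ ᾱ of (L/2)·(Σ_{h ∈ G} α_h² − 1/L) / D(α, ᾱ) equals L(L−2) / (2(L−1)·log(L−1)). -/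
open Real

theorem two_mul_sub_one_le_add_one_mul_log {s : ℝ} (hs : 1 ≤ s) :
    2 * (s - 1) ≤ (s + 1) * log s := by
  have h := Real.le_log_one_add_of_nonneg (sub_nonneg.2 hs)
  rw [div_le_iff₀ (by linarith)] at h
  rw [add_sub_cancel] at h
  linarith

theorem log_le_half_sub_inv {u : ℝ} (hu : 1 ≤ u) : log u ≤ (u - u⁻¹) / 2 := by
  rw [← Real.sinh_log (by linarith)]
  exact Real.self_le_sinh_iff.2 (Real.log_nonneg hu)

theorem mul_log_mul_sq_le {s m : ℝ} (hs : 1 ≤ s) (hsm : s ≤ m) :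
    m * log m * (s - 1) ^ 2 ≤ (s * log s - s + 1) * (m + s) * (m - 1) := by
  have hs0 : 0 < s := by linarith
  have hm0 : 0 < m := by linarith
  have hA := two_mul_sub_one_le_add_one_mul_log hs
  have hlog : log m = log s + log (m / s) := by
    rw [Real.log_div hm0.ne' hs0.ne']; ring
  have hu : m * log (m / s) * (s + 1) ≤ (m - s) * (m + 1) := by
    have h := log_le_half_sub_inv ((one_le_div hs0).2 hsm)
    have h2 : (m / s - (m / s)⁻¹) / 2 = (m - s) * (m + s) / (2 * m * s) := by
      field_simp; ring
    rw [h2, le_div_iff₀ (by positivity)] at h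
    have h3 : (m - s) * (m + s) * (s + 1) ≤ (m - s) * (m + 1) * (2 * s) := by
      nlinarith [mul_nonneg (mul_nonneg (sub_nonneg.2 hsm) (sub_nonneg.2 hs))
        (sub_nonneg.2 hsm)]
    have h4 : m * log (m / s) * (s + 1) * (2 * s) ≤ (m - s) * (m + 1) * (2 * s) := by
      nlinarith
    exact le_of_mul_le_mul_right h4 (by positivity)
  have hB : (s - 1) ^ 2 ≤ (s * log s - s + 1) * (s + 1) := by nlinarith
  have hC : m * log (m / s) * (s - 1) ^ 2 ≤ (s * log s - s + 1) * ((m - s) * (m + 1)) := by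
    have h0 : 0 ≤ (m - s) * (m + 1) := mul_nonneg (by linarith) (by linarith)
    have h1 : m * log (m / s) * (s + 1) * (s - 1) ^ 2 ≤ (m - s) * (m + 1) * (s - 1) ^ 2 :=
      mul_le_mul_of_nonneg_right hu (sq_nonneg _)
    have h2 := mul_le_mul_of_nonneg_left hB h0
    have h3 : m * log (m / s) * (s - 1) ^ 2 * (s + 1)
        ≤ (s * log s - s + 1) * ((m - s) * (m + 1)) * (s + 1) := by linarith
    exact le_of_mul_le_mul_right h3 (by linarith)
  have hD : 0 ≤ m * (s - 1) * ((s + 1) * log s - 2 * (s - 1)) :=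
    mul_nonneg (mul_nonneg hm0.le (by linarith)) (by linarith)
  rw [hlog]
  linarith

theorem hasDerivAt_mul_log_sub_add_one {t : ℝ} (ht : 0 < t) :
    HasDerivAt (fun t : ℝ => t * log t - t + 1) (log t) t := by
  have h := (((Real.hasDerivAt_mul_log ht.ne').sub (hasDerivAt_id t)).add_const 1)
  simpa using h

theorem antitoneOn_mul_log_sub_half_sq :
    AntitoneOn (fun t : ℝ => t * log t - t + 1 - (t - 1) ^ 2 / 2) (Set.Ici 0) := by
  have hd : ∀ t : ℝ, 0 < t → HasDerivAt (fun t : ℝ => t * log t - t + 1 - (t - 1) ^ 2 / 2)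
      (log t - (t - 1)) t := fun t ht => by
    refine ((hasDerivAt_mul_log_sub_add_one ht).sub
      ((((hasDerivAt_id t).sub_const 1).pow 2).div_const 2)).congr_deriv ?_
    simp
  refine antitoneOn_of_deriv_nonpos (convex_Ici 0) ?_ ?_ ?_
  · exact Continuous.continuousOn (by have := Real.continuous_mul_log; fun_prop)
  · intro t ht
    rw [interior_Ici] at ht
    exact (hd t ht).differentiableAt.differentiableWithinAt
  · intro t ht
    rw [interior_Ici] at ht
    rw [(hd t ht).deriv]
    linarith [Real.log_le_sub_one_of_pos ht]

theorem antitoneOn_mul_log_div_sq :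
    AntitoneOn (fun t : ℝ => (t * log t - t + 1) / (t - 1) ^ 2) (Set.Ioi 1) := by
  have hd : ∀ t : ℝ, 1 < t → HasDerivAt (fun t : ℝ => (t * log t - t + 1) / (t - 1) ^ 2)
      ((log t * (t - 1) ^ 2 - (t * log t - t + 1) * (2 * (t - 1))) / ((t - 1) ^ 2) ^ 2) t :=
    fun t ht => by
      refine ((hasDerivAt_mul_log_sub_add_one (by linarith)).div
        (((hasDerivAt_id t).sub_const 1).pow 2)
        (pow_ne_zero 2 (sub_ne_zero.2 ht.ne'))).congr_deriv ?_
      simp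
  refine antitoneOn_of_deriv_nonpos (convex_Ioi 1) ?_ ?_ ?_
  · exact fun t ht => (hd t ht).continuousAt.continuousWithinAt
  · intro t ht
    rw [interior_Ioi] at ht
    exact (hd t ht).differentiableAt.differentiableWithinAt
  · intro t ht
    rw [interior_Ioi] at ht
    have ht : 1 < t := ht
    rw [(hd t ht).deriv]
    refine div_nonpos_of_nonpos_of_nonneg ?_ (by positivity)
    have := mul_nonneg (sub_nonneg.2 ht.le)
      (sub_nonneg.2 (two_mul_sub_one_le_add_one_mul_log ht.le))
    linarith

theorem mul_sq_le_mul_log {K s t : ℝ} (hK : K ≤ 1 / 2)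
    (hKs : K * (s - 1) ^ 2 ≤ s * log s - s + 1) (ht : 0 ≤ t) (hts : t ≤ s) :
    K * (t - 1) ^ 2 ≤ t * log t - t + 1 := by
  rcases le_total t 1 with h | h
  · have h1 := antitoneOn_mul_log_sub_half_sq (Set.mem_Ici.2 ht)
      (Set.mem_Ici.2 zero_le_one) h
    simp only [Real.log_one] at h1
    have h2 := mul_le_mul_of_nonneg_right hK (sq_nonneg (t - 1))
    linarith
  · rcases h.eq_or_lt with rfl | h
    · simp
    · have hs : 1 < s := h.trans_le hts
      have h1 := antitoneOn_mul_log_div_sq (Set.mem_Ioi.2 h) (Set.mem_Ioi.2 hs) hts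
      rw [← le_div_iff₀ (pow_pos (sub_pos.2 hs) 2)] at hKs
      exact (le_div_iff₀ (pow_pos (sub_pos.2 h) 2)).1 (hKs.trans h1)

theorem concaveOn_log_sub_log_one_sub :
    ConcaveOn ℝ (Set.Ioc 0 (1 / 2)) (fun x : ℝ => log x - log (1 - x)) := by
  have hd : ∀ x : ℝ, 0 < x → x < 1 →
      HasDerivAt (fun x : ℝ => log x - log (1 - x)) (1 / (x * (1 - x))) x := fun x h0 h1 => by
    have h1' : 1 - x ≠ 0 := by linarith
    refine ((Real.hasDerivAt_log h0.ne').sub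
      (((hasDerivAt_id x).const_sub 1).log h1')).congr_deriv ?_
    simp only [id]
    field_simp
    ring
  refine AntitoneOn.concaveOn_of_deriv (convex_Ioc 0 (1 / 2)) ?_ ?_ ?_
  · intro x hx
    exact (hd x hx.1 (by linarith [hx.2])).continuousAt.continuousWithinAt
  · intro x hx
    rw [interior_Ioc] at hx
    exact (hd x hx.1 (by linarith [hx.2])).differentiableAt.differentiableWithinAt
  · intro x hx y hy hxy
    rw [interior_Ioc] at hx hy
    rw [(hd x hx.1 (by linarith [hx.2])).deriv, (hd y hy.1 (by linarith [hy.2])).deriv]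
    refine one_div_le_one_div_of_le (mul_pos hx.1 (by linarith [hx.2])) ?_
    nlinarith [hx.2, hy.2]

theorem sq_sub_le_binary_relative_entropy_of_le_half {m x : ℝ} (hm : 1 < m) (h0 : 0 ≤ x)
    (hx : x ≤ 1 / 2) :
    m * log m / (m - 1) * (x ^ 2 + (1 - x) ^ 2 / m - 1 / (m + 1)) ≤
      x * log x + (1 - x) * log (1 - x) - (1 - x) * log m + log (m + 1) := by
  have hm0 : 0 < m := by linarith
  have hm1 : m - 1 ≠ 0 := by linarith
  have hmp : 0 < m + 1 := by linarith
  set κ := m * log m / (m - 1) with hκ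
  set g : ℝ → ℝ := fun x => x * log x + (1 - x) * log (1 - x) - (1 - x) * log m + log (m + 1)
    - κ * (x ^ 2 + (1 - x) ^ 2 / m - 1 / (m + 1)) with hg
  set g' : ℝ → ℝ := fun x => log x - log (1 - x) + (log m - κ * (2 * x - 2 * (1 - x) / m))
    with hg'
  have hd : ∀ x : ℝ, 0 < x → x < 1 → HasDerivAt g (g' x) x := fun x h0 h1 => by
    have e1 := (hasDerivAt_id x).const_sub 1
    have e2 := (Real.hasDerivAt_mul_log (x := 1 - x) (by linarith)).comp x e1
    have e3 := ((((Real.hasDerivAt_mul_log h0.ne').add e2).sub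
      (e1.mul_const (log m))).add_const (log (m + 1))).sub
        (((((hasDerivAt_id x).pow 2).add ((e1.pow 2).div_const m)).sub_const
          (1 / (m + 1))).const_mul κ)
    refine e3.congr_deriv ?_
    simp only [hg', id]
    push_cast
    ring
  have hcont : Continuous g := by
    have e1 := Real.continuous_mul_log
    have e2 := e1.comp (continuous_const.sub continuous_id : Continuous fun x : ℝ => 1 - x)
    have e3 : Continuous fun x : ℝ => (1 - x) * log (1 - x) := e2
    simp only [hg]
    fun_prop
  have hconc : ConcaveOn ℝ (Set.Ioc 0 (1 / 2)) g' := by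
    refine concaveOn_log_sub_log_one_sub.add ⟨convex_Ioc _ _, ?_⟩
    intro x _ y _ a b _ _ hab
    obtain rfl : b = 1 - a := by linarith
    simp only [smul_eq_mul]
    apply le_of_eq
    ring
  set q := 1 / (m + 1) with hq
  have hq0 : 0 < q := by positivity
  have hq2 : q < 1 / 2 := one_div_lt_one_div_of_lt two_pos (by linarith)
  have h1q : 1 - q = m / (m + 1) := by rw [hq]; field_simp; ring
  have hlq : log q = - log (m + 1) := by rw [hq, one_div, Real.log_inv]
  have hl1q : log (1 - q) = log m - log (m + 1) := by rw [h1q, Real.log_div hm0.ne' hmp.ne']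
  have hg'half : g' (1 / 2) = 0 := by
    simp only [hg', hκ]
    norm_num
    field_simp
    ring
  have hg'q : g' q = 0 := by
    simp only [hg', hlq, hl1q]
    rw [h1q, hq]
    field_simp
    ring
  have hgq : g q = 0 := by
    simp only [hg, hlq, hl1q]
    rw [h1q, hq]
    field_simp
    ring
  suffices h : g q ≤ g x by
    rw [hgq] at h
    simp only [hg] at h
    linarith
  rcases le_total x q with hxq | hxq
  · have hanti : AntitoneOn g (Set.Icc 0 q) := by
      refine antitoneOn_of_deriv_nonpos (convex_Icc 0 q) hcont.continuousOn ?_ ?_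
      · intro t ht
        rw [interior_Icc] at ht
        exact (hd t ht.1 (by linarith [ht.2])).differentiableAt.differentiableWithinAt
      · intro t ht
        rw [interior_Icc] at ht
        rw [(hd t ht.1 (by linarith [ht.2])).deriv]
        have h := hconc.slope_anti_adjacent (x := t) (y := q) (z := 1 / 2)
          ⟨ht.1, by linarith [ht.2]⟩ ⟨by norm_num, le_rfl⟩ ht.2 hq2
        rw [hg'half, hg'q, sub_zero, zero_div, le_div_iff₀ (sub_pos.2 ht.2)] at h
        linarith
    exact hanti ⟨h0, hxq⟩ ⟨hq0.le, le_rfl⟩ hxq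
  · have hmono : MonotoneOn g (Set.Icc q (1 / 2)) := by
      refine monotoneOn_of_deriv_nonneg (convex_Icc _ _) hcont.continuousOn ?_ ?_
      · intro t ht
        rw [interior_Icc] at ht
        exact (hd t (by linarith [ht.1])
          (by linarith [ht.2])).differentiableAt.differentiableWithinAt
      · intro t ht
        rw [interior_Icc] at ht
        rw [(hd t (by linarith [ht.1]) (by linarith [ht.2])).deriv]
        have h := hconc.min_le_of_mem_Icc ⟨hq0, hq2.le⟩ ⟨by norm_num, le_rfl⟩
          (Set.Ioo_subset_Icc_self ht)
        rwa [hg'half, hg'q, min_self] at h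
    exact hmono ⟨le_rfl, hq2.le⟩ ⟨hxq, hx⟩ hxq

/-- The logarithmic Sobolev inequality for a Bernoulli variable, relative to the law
`(1 / (m + 1), m / (m + 1))`. -/
theorem sq_sub_le_binary_relative_entropy {m x : ℝ} (hm : 1 < m) (h0 : 0 ≤ x) (h1 : x ≤ 1) :
    m * log m / (m - 1) * (x ^ 2 + (1 - x) ^ 2 / m - 1 / (m + 1)) ≤
      x * log x + (1 - x) * log (1 - x) - (1 - x) * log m + log (m + 1) := by
  rcases le_total x (1 / 2) with hx | hx
  · exact sq_sub_le_binary_relative_entropy_of_le_half hm h0 hx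
  · have h := sq_sub_le_binary_relative_entropy_of_le_half (x := 1 - x) hm (by linarith)
      (by linarith)
    have hm1 : m - 1 ≠ 0 := by linarith
    have hm0 : m ≠ 0 := by linarith
    have e : m * log m / (m - 1) * (x ^ 2 + (1 - x) ^ 2 / m - 1 / (m + 1)) =
        m * log m / (m - 1) * ((1 - x) ^ 2 + x ^ 2 / m - 1 / (m + 1)) + (2 * x - 1) * log m := by
      field_simp
      ring
    rw [sub_sub_cancel] at h
    rw [e]
    linarith

/-- Lower bound on the relative entropy of a probability vector with respect to the uniform one
by its squared Euclidean distance, with the optimal constant. -/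
theorem sum_sq_sub_le_sum_mul_log {ι : Type*} [Fintype ι] {m : ℝ} (hm : 1 < m)
    (hcard : (Fintype.card ι : ℝ) = m + 1) {p : ι → ℝ} (hp : ∀ i, 0 ≤ p i)
    (hsum : ∑ i, p i = 1) :
    m * log m / (m - 1) * (∑ i, p i ^ 2 - 1 / (m + 1)) ≤
      ∑ i, p i * log (p i) + log (m + 1) := by
  classical
  have hm0 : 0 < m := by linarith
  have hm1 : 0 < m - 1 := by linarith
  have hmp : 0 < m + 1 := by linarith
  have hlogm : 0 < log m := Real.log_pos hm
  set κ := m * log m / (m - 1) with hκ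
  have hκ0 : 0 < κ := by positivity
  have hne : Nonempty ι := by
    rw [← Fintype.card_pos_iff]
    have : (0 : ℝ) < Fintype.card ι := by linarith
    exact_mod_cast this
  obtain ⟨i, hi⟩ := Finite.exists_max p
  set S := Finset.univ.erase i with hS
  have hsplit : ∀ f : ι → ℝ, ∑ j, f j = f i + ∑ j ∈ S, f j := fun f =>
    (Finset.add_sum_erase _ f (Finset.mem_univ i)).symm
  have hSsum : ∑ j ∈ S, p j = 1 - p i := by linarith [hsplit p]
  have hScard : ((S.card : ℕ) : ℝ) = m := by
    have := hsplit fun _ => 1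
    simp at this
    linarith
  set x := p i with hx
  have hx0 : 0 ≤ x := hp i
  have hx1 : x ≤ 1 := by
    linarith [Finset.sum_nonneg fun j (_ : j ∈ S) => hp j]
  have hple : ∀ j ∈ S, p j ≤ 1 - x := fun j hj => by
    rw [← hSsum]; exact Finset.single_le_sum (fun k _ => hp k) hj
  have hxL : 1 ≤ x * (m + 1) := by
    have := Finset.sum_le_sum fun j (_ : j ∈ Finset.univ) => hi j
    rw [hsum] at this
    simp [hcard] at this
    linarith
  have hbin := sq_sub_le_binary_relative_entropy hm hx0 hx1
  rw [hsplit fun j => p j ^ 2, hsplit fun j => p j * log (p j)]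
  suffices h : κ * (∑ j ∈ S, p j ^ 2 - (1 - x) ^ 2 / m) ≤
      ∑ j ∈ S, p j * log (p j) - ((1 - x) * log (1 - x) - (1 - x) * log m) by
    rw [← hκ] at hbin
    simp only [← hx]
    linarith
  rcases hx1.eq_or_lt with h1 | h1
  · have hz : ∀ j ∈ S, p j = 0 := fun j hj => le_antisymm (by linarith [hple j hj]) (hp j)
    rw [Finset.sum_eq_zero fun j hj => by rw [hz j hj]; norm_num,
      Finset.sum_eq_zero fun j hj => by rw [hz j hj]; norm_num, h1]
    norm_num
  set y := (1 - x) / m with hy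
  have hy0 : 0 < y := div_pos (by linarith) hm0
  have hym : y * m = 1 - x := div_mul_cancel₀ _ hm0.ne'
  have hyle : y * (m + 1) ≤ 1 := by nlinarith
  have hK : κ * y ≤ 1 / 2 := by
    have h := log_le_half_sub_inv hm.le
    have h2 : κ ≤ (m + 1) / 2 := by
      rw [hκ, div_le_iff₀ hm1]
      have := mul_le_mul_of_nonneg_left h hm0.le
      have e : m * ((m - m⁻¹) / 2) = (m + 1) / 2 * (m - 1) := by field_simp; ring
      linarith
    have := mul_le_mul_of_nonneg_right h2 hy0.le
    linarith
  obtain ⟨s, hs, hts⟩ : ∃ s : ℝ, κ * y * (s - 1) ^ 2 ≤ s * log s - s + 1 ∧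
      ∀ j ∈ S, p j ≤ s * y := by
    rcases le_total x (1 / 2) with hx2 | hx2
    · refine ⟨x / y, ?_, fun j _ => by rw [div_mul_cancel₀ _ hy0.ne']; exact hi j⟩
      set s := x / y with hs
      have hsy : s * y = x := div_mul_cancel₀ _ hy0.ne'
      have hs1 : 1 ≤ s := by rw [hs, one_le_div hy0]; nlinarith
      have hsm : s ≤ m := by rw [hs, div_le_iff₀ hy0]; linarith
      have h := mul_log_mul_sq_le hs1 hsm
      have hms : y * (m + s) = 1 := by linarith
      have h2 := mul_le_mul_of_nonneg_left h hy0.le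
      rw [hκ, div_mul_eq_mul_div, div_mul_eq_mul_div, div_le_iff₀ hm1]
      calc m * log m * y * (s - 1) ^ 2 ≤ (s * log s - s + 1) * (y * (m + s)) * (m - 1) := by
            linarith
        _ = _ := by rw [hms, mul_one]
    · refine ⟨m, ?_, fun j hj => by linarith [hple j hj]⟩
      have e : κ * y * (m - 1) ^ 2 = log m * (y * m) * (m - 1) := by
        rw [hκ]; field_simp
      have h := mul_le_mul_of_nonneg_left (show y * m ≤ 1 / 2 by linarith)
        (mul_nonneg hlogm.le hm1.le)
      linarith [two_mul_sub_one_le_add_one_mul_log hm.le]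
  have hpt : ∀ j ∈ S, κ * (p j - y) ^ 2 ≤ p j * log (p j) - p j * log y - p j + y := by
    intro j hj
    have h := mul_sq_le_mul_log hK hs (div_nonneg (hp j) hy0.le)
      ((div_le_iff₀ hy0).2 (hts j hj))
    have hl : p j * log (p j / y) = p j * log (p j) - p j * log y := by
      rcases (hp j).eq_or_lt with h0 | h0
      · simp [← h0]
      · rw [Real.log_div h0.ne' hy0.ne']; ring
    have h2 := mul_le_mul_of_nonneg_left h hy0.le
    have e1 : y * (κ * y * (p j / y - 1) ^ 2) = κ * (p j - y) ^ 2 := by field_simp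
    have e2 : y * (p j / y * log (p j / y) - p j / y + 1) = p j * log (p j / y) - p j + y := by
      field_simp
    linarith
  have hfin := Finset.sum_le_sum hpt
  have e1 : ∑ j ∈ S, κ * (p j - y) ^ 2 = κ * (∑ j ∈ S, p j ^ 2 - (1 - x) ^ 2 / m) := by
    rw [← Finset.mul_sum]
    congr 1
    simp only [sub_sq, Finset.sum_add_distrib, Finset.sum_sub_distrib, ← Finset.sum_mul,
      ← Finset.mul_sum, hSsum, Finset.sum_const, nsmul_eq_mul, hScard]
    rw [hy]
    field_simp
    ring
  have e2 : ∑ j ∈ S, (p j * log (p j) - p j * log y - p j + y) =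
      ∑ j ∈ S, p j * log (p j) - ((1 - x) * log (1 - x) - (1 - x) * log m) := by
    simp only [Finset.sum_add_distrib, Finset.sum_sub_distrib, ← Finset.sum_mul, hSsum,
      Finset.sum_const, nsmul_eq_mul, hScard]
    rw [mul_comm m y, hym, hy, Real.log_div (by linarith) hm0.ne']
    ring
  rwa [e1, e2] at hfin

/-- The log-sum inequality with constant reference weights `1 / n ^ 2`. -/
theorem sum_mul_log_le_sum_mul_log_sq_mul {ι : Type*} [Fintype ι] {n : ℝ} (hn : 0 < n)
    (hcard : (Fintype.card ι : ℝ) = n) {f : ι → ℝ} (hf : ∀ a, 0 ≤ f a) :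
    (∑ a, f a) * log (n * ∑ a, f a) ≤ ∑ a, f a * log (n ^ 2 * f a) := by
  set P := ∑ a, f a with hP
  rcases (Finset.sum_nonneg fun a (_ : a ∈ Finset.univ) => hf a).eq_or_lt with h0 | h0
  · have hz := (Finset.sum_eq_zero_iff_of_nonneg fun a _ => hf a).1 h0.symm
    rw [hP, ← h0, Finset.sum_eq_zero fun a ha => by rw [hz a ha, zero_mul]]
    simp
  rw [← hP] at h0
  have hpt : ∀ a ∈ Finset.univ, f a * log (n * P) + (f a - P / n) ≤ f a * log (n ^ 2 * f a) := by
    intro a _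
    rcases (hf a).eq_or_lt with h | h
    · rw [← h]
      simp only [zero_mul, zero_add, zero_sub, neg_nonpos]
      positivity
    · have e : n ^ 2 * f a = (n * P) * (P / (n * f a))⁻¹ := by field_simp
      rw [e, Real.log_mul (x := n * P) (by positivity) (by positivity), Real.log_inv]
      have hl := mul_le_mul_of_nonneg_left
        (Real.log_le_sub_one_of_pos (show 0 < P / (n * f a) by positivity)) h.le
      have e2 : f a * (P / (n * f a) - 1) = P / n - f a := by field_simp
      linarith
  have h := Finset.sum_le_sum hpt
  have e : ∑ a, (f a * log (n * P) + (f a - P / n)) = P * log (n * P) := by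
    simp only [Finset.sum_add_distrib, Finset.sum_sub_distrib, ← Finset.sum_mul, ← hP,
      Finset.sum_const, nsmul_eq_mul, Finset.card_univ, hcard]
    field_simp
    ring
  rwa [e] at h

theorem sum_prod_eq_sum_sum_mul {G : Type*} [Group G] [Fintype G] (F : G × G → ℝ) :
    ∑ q, F q = ∑ h : G, ∑ a : G, F (a, a * h) := by
  rw [Fintype.sum_prod_type, Finset.sum_comm (f := fun h a => F (a, a * h))]
  exact Finset.sum_congr rfl fun a _ => (Equiv.sum_comp (Equiv.mulLeft a) fun b => F (a, b)).symm

/-- The truth-or-Haar matrix optimization problem: for a finite group `G` of order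
`L ≥ 3`, the supremum of `(L/2)(∑_h α_h² - 1/L) / D(α, ᾱ)` over nonnegative
matrices `α : G × G → ℝ` with all row- and column-sums equal to `1/L` and `α ≠ ᾱ`,
where `α_h = ∑_{a⁻¹b = h} α_{ab}` and `D(α,ᾱ) = ∑ α_{ab} log(L² α_{ab})`, equals
`L(L-2) / (2(L-1) log(L-1))`. -/
theorem stmt_17 {G : Type*} [Group G] [Fintype G]
    (hL : 3 ≤ Fintype.card G) :
    IsLUB
      { r : ℝ | ∃ α : G × G → ℝ,
          (∀ q, 0 ≤ α q) ∧
          (∀ a : G, ∑ b : G, α (a, b) = 1 / (Fintype.card G : ℝ)) ∧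
          (∀ b : G, ∑ a : G, α (a, b) = 1 / (Fintype.card G : ℝ)) ∧
          α ≠ (fun _ => 1 / (Fintype.card G : ℝ) ^ 2) ∧
          r = ((Fintype.card G : ℝ) / 2) *
                ((∑ h : G, (∑ a : G, α (a, a * h)) ^ 2) - 1 / (Fintype.card G : ℝ)) /
              (∑ q : G × G, α q * Real.log ((Fintype.card G : ℝ) ^ 2 * α q)) }
      ((Fintype.card G : ℝ) * ((Fintype.card G : ℝ) - 2) /
        (2 * ((Fintype.card G : ℝ) - 1) * Real.log ((Fintype.card G : ℝ) - 1))) := by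
  classical
  set L : ℝ := (Fintype.card G : ℝ) with hLdef
  have hL3 : (3 : ℝ) ≤ L := by rw [hLdef]; exact_mod_cast hL
  obtain ⟨m, hm⟩ : ∃ m : ℝ, m = L - 1 := ⟨_, rfl⟩
  have hLm : L = m + 1 := by linarith
  have hm1 : 1 < m := by linarith
  have hm1' : 0 < m - 1 := by linarith
  have hm0 : 0 < m := by linarith
  have hL0 : 0 < L := by linarith
  have hlog : 0 < log m := Real.log_pos hm1
  rw [← hm, show L - 2 = m - 1 by linarith]
  refine IsGreatest.isLUB ⟨?_, ?_⟩
  · set u : ℝ := m / L ^ 2 with hu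
    set v : ℝ := 1 / (L ^ 2 * m) with hv
    have huv : u + m * v = 1 / L := by rw [hu, hv, hLm]; field_simp
    have hite : ∀ (z w : ℝ) (c : G), ∑ b : G, (if b = c then z else w) = z + m * w := by
      intro z w c
      rw [← Finset.add_sum_erase _ _ (Finset.mem_univ c), if_pos rfl,
        Finset.sum_congr rfl fun b hb => if_neg (Finset.ne_of_mem_erase hb), Finset.sum_const,
        nsmul_eq_mul, Finset.card_erase_of_mem (Finset.mem_univ c), Finset.card_univ,
        Nat.cast_sub (by omega), Nat.cast_one, ← hLdef, hm]
    refine ⟨fun q => if q.2 = q.1 then u else v, ?_, ?_, ?_, ?_, ?_⟩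
    · intro q
      dsimp only
      split_ifs <;> positivity
    · intro a
      rw [← huv]
      exact hite u v a
    · intro b
      rw [← huv]
      simp only [eq_comm (a := b)]
      exact hite u v b
    · intro h
      have h1 := congrFun h (1, 1)
      simp only [if_true, hu] at h1
      rw [div_left_inj' (by positivity)] at h1
      linarith
    · have hdiag : ∀ h : G, (∑ a : G, if a * h = a then u else v) =
          if h = 1 then L * u else L * v := by
        intro h
        simp only [mul_eq_left]
        split_ifs <;> simp [hLdef]
      have hD : ∑ q : G × G, (if q.2 = q.1 then u else v) *
          log (L ^ 2 * (if q.2 = q.1 then u else v)) = (m - 1) * log m / L := by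
        have hLu : L ^ 2 * u = m := by rw [hu]; field_simp
        have hLv : L ^ 2 * v = m⁻¹ := by rw [hv]; field_simp
        rw [Fintype.sum_prod_type]
        have : ∀ a b : G, (if b = a then u else v) * log (L ^ 2 * (if b = a then u else v)) =
            if b = a then u * log m else v * -log m := by
          intro a b
          split_ifs
          · rw [hLu]
          · rw [hLv, Real.log_inv]
        simp only [this, hite]
        rw [Finset.sum_const, nsmul_eq_mul, Finset.card_univ, ← hLdef, hu, hv]
        field_simp
        ring
      have hN : ∑ h : G, (∑ a : G, if a * h = a then u else v) ^ 2 =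
          (L * u) ^ 2 + m * (L * v) ^ 2 := by
        simp only [hdiag, ite_pow]
        exact hite _ _ 1
      simp only [hD, hN]
      rw [hu, hv, hLm]
      field_simp
      ring
  · rintro r ⟨α, hα, hrow, -, -, rfl⟩
    set p : G → ℝ := fun h => ∑ a : G, α (a, a * h) with hp
    have hp0 : ∀ h, 0 ≤ p h := fun h => Finset.sum_nonneg fun a _ => hα _
    have hpsum : ∑ h, p h = 1 := by
      rw [hp, ← sum_prod_eq_sum_sum_mul, Fintype.sum_prod_type]
      simp only [hrow, Finset.sum_const, nsmul_eq_mul, Finset.card_univ, ← hLdef]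
      field_simp
    set D := ∑ q : G × G, α q * log (L ^ 2 * α q) with hDdef
    have hN0 : 0 ≤ ∑ h, p h ^ 2 - 1 / L := by
      have h := sq_sum_le_card_mul_sum_sq (s := Finset.univ) (f := p)
      rw [hpsum, Finset.card_univ, ← hLdef] at h
      rw [sub_nonneg, div_le_iff₀ hL0]
      linarith
    have hent : m * log m / (m - 1) * (∑ h, p h ^ 2 - 1 / L) ≤ D := by
      have h1 := sum_sq_sub_le_sum_mul_log hm1 (hLdef.symm.trans hLm) hp0 hpsum
      have h2 : ∑ h, p h * log (L * p h) ≤ D := by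
        rw [hDdef, sum_prod_eq_sum_sum_mul]
        exact Finset.sum_le_sum fun h _ =>
          sum_mul_log_le_sum_mul_log_sq_mul hL0 hLdef.symm fun a => hα _
      have h3 : ∑ h, p h * log (L * p h) = ∑ h, p h * log (p h) + log L := by
        have : ∀ h, p h * log (L * p h) = p h * log (p h) + p h * log L := by
          intro h
          rcases (hp0 h).eq_or_lt with h0 | h0
          · simp [← h0]
          · rw [Real.log_mul hL0.ne' h0.ne']; ring
        simp only [this, Finset.sum_add_distrib, ← Finset.sum_mul, hpsum, one_mul]
      rw [← hLm] at h1
      linarith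
    have hD0 : 0 ≤ D := le_trans (mul_nonneg (by positivity) hN0) hent
    refine div_le_of_le_mul₀ hD0 (by positivity) ?_
    have h := mul_le_mul_of_nonneg_left hent
      (show 0 ≤ L * (m - 1) / (2 * m * log m) by positivity)
    refine le_trans (le_of_eq ?_) h
    change L / 2 * (∑ h, p h ^ 2 - 1 / L) = _
    field_simp
end

section
/- Let G be a finite group of order L ≥ 3 and let p̃ ≥ 0 satisfy p̃ < √( 2(L−1)·log(L−1) / (L(L−2)) ). For each n (large enough that p := p̃/√n ≤ 1), define two probability measures on G-valued arrays (Y_{uv})_{1 ≤ u < v ≤ n}: under the spiked truth-or-Haar measure P_n, a vector g ∈ Gⁿ is drawn with i.i.d. uniform coordinates, and independently for each pair u < v one sets Y_{uv} = g_u·g_v⁻¹ with probability p and Y_{uv} uniform on G with probability 1−p; under the unspiked measure Q_n, all Y_{uv} are i.i.d. uniform on G. Then P_n is contiguous to Q_n. -/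
open MeasureTheory Filter Topology
open scoped ENNReal NNReal

/-- A sequence of probability measures `P n` is contiguous to `Q n` if for every
sequence of measurable events `A n`, `Q n (A n) → 0` implies `P n (A n) → 0`. -/
def Contiguous {Ω : ℕ → Type*} [∀ n, MeasurableSpace (Ω n)]
    (P Q : (n : ℕ) → Measure (Ω n)) : Prop :=
  ∀ A : (n : ℕ) → Set (Ω n), (∀ n, MeasurableSet (A n)) →
    Tendsto (fun n => Q n (A n)) atTop (𝓝 0) →
    Tendsto (fun n => P n (A n)) atTop (𝓝 0)

/-- The uniform (Haar) probability measure on a finite group `G`. -/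
noncomputable def uniformG (G : Type*) [Fintype G] [Nonempty G] [MeasurableSpace G] :
    Measure G :=
  (PMF.uniformOfFintype G).toMeasure

instance (G : Type*) [Fintype G] [Nonempty G] [MeasurableSpace G] :
    IsProbabilityMeasure (uniformG G) := by
  unfold uniformG; infer_instance

/-- A truth-or-Haar edge observation: with probability `p` it is the true value `y`,
otherwise it is uniform on `G`. -/
noncomputable def tohEdge {G : Type*} [Fintype G] [Nonempty G] [MeasurableSpace G]
    (p : ℝ) (y : G) : Measure G :=
  p.toNNReal • Measure.dirac y + (1 - p).toNNReal • uniformG G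

instance {G : Type*} [Fintype G] [Nonempty G] [MeasurableSpace G] (p : ℝ) (y : G) :
    IsFiniteMeasure (tohEdge p y) := by
  unfold tohEdge; infer_instance

/-- The spiked truth-or-Haar measure `ToH_n(p̃, G)` on arrays `(Y_{uv})_{u<v}`:
a vector `g ∈ Gⁿ` is drawn with i.i.d. uniform coordinates, and independently for
each pair `u < v`, `Y_{uv} = g_u g_v⁻¹` with probability `p = p̃/√n` and `Y_{uv}`
is uniform on `G` otherwise. -/
noncomputable def tohSpiked (G : Type*) [Group G] [Fintype G] [Nonempty G]
    [MeasurableSpace G] (n : ℕ) (pt : ℝ) :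
    Measure ({q : Fin n × Fin n // q.1 < q.2} → G) :=
  (Measure.pi fun _ : Fin n => uniformG G).bind fun g =>
    Measure.pi fun q : {q : Fin n × Fin n // q.1 < q.2} =>
      tohEdge (pt / Real.sqrt n) (g q.1.1 * (g q.1.2)⁻¹)

/-- The unspiked truth-or-Haar measure: all `Y_{uv}` i.i.d. uniform on `G`. -/
noncomputable def tohUnspiked (G : Type*) [Fintype G] [Nonempty G] [MeasurableSpace G]
    (n : ℕ) : Measure ({q : Fin n × Fin n // q.1 < q.2} → G) :=
  Measure.pi fun _ : {q : Fin n × Fin n // q.1 < q.2} => uniformG G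

lemma logit_tangent_sign {m : ℝ} (hm : 2 ≤ m) {b : ℝ} (hb0 : 0 < b) (hb : b ≤ (m + 1) / 2) :
    0 ≤ (b - 1) * (Real.log b - Real.log ((m + 1 - b) / m) -
      2 * (Real.log m / (m - 1)) * (b - 1)) := by
  set κ := Real.log m / (m - 1) with hκ
  have hκm : κ * (m - 1) = Real.log m := by
    rw [hκ]; field_simp [show m - 1 ≠ 0 by linarith]
  set f : ℝ → ℝ := fun b => Real.log b - Real.log (m + 1 - b) with hf
  have hd : ∀ x ∈ Set.Ioo 0 (m + 1), HasDerivAt f (1 / x + 1 / (m + 1 - x)) x := by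
    intro x hx
    have h1 := Real.hasDerivAt_log (ne_of_gt hx.1)
    have h2 : HasDerivAt (fun y : ℝ => Real.log (m + 1 - y)) (-1 / (m + 1 - x)) x :=
      ((hasDerivAt_id x).const_sub (m + 1)).log (by simp; linarith [hx.2])
    exact (h1.sub h2).congr_deriv (by ring)
  have hconc : ConcaveOn ℝ (Set.Ioc 0 ((m + 1) / 2)) f := by
    apply AntitoneOn.concaveOn_of_deriv (convex_Ioc _ _)
    · intro x hx
      exact (hd x ⟨hx.1, by linarith [hx.2]⟩).continuousAt.continuousWithinAt
    · intro x hx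
      rw [interior_Ioc] at hx
      exact (hd x ⟨hx.1, by linarith [hx.2]⟩).differentiableAt.differentiableWithinAt
    · intro x hx y hy hxy
      rw [interior_Ioc] at hx hy
      rw [(hd x ⟨hx.1, by linarith [hx.2]⟩).deriv, (hd y ⟨hy.1, by linarith [hy.2]⟩).deriv]
      have e : ∀ z ∈ Set.Ioo 0 ((m + 1) / 2), 1 / z + 1 / (m + 1 - z) =
          (m + 1) / (z * (m + 1 - z)) := by
        intro z hz
        have : m + 1 - z ≠ 0 := by linarith [hz.2]
        have : z ≠ 0 := hz.1.ne'
        field_simp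
        ring
      rw [e x hx, e y hy]
      apply div_le_div_of_nonneg_left (by linarith)
      · exact mul_pos hx.1 (by linarith [hx.2])
      · nlinarith [hx.1, hx.2, hy.1, hy.2]
  have hf1 : f 1 = - Real.log m := by simp [hf]
  have hfh : f ((m + 1) / 2) = 0 := by
    simp only [hf]; rw [show m + 1 - (m + 1) / 2 = (m + 1) / 2 by ring]; ring
  have hfb : Real.log b - Real.log ((m + 1 - b) / m) = f b + Real.log m := by
    rw [Real.log_div (by linarith) (by linarith)]; simp only [hf]; ring
  rw [hfb]
  have m1 : (1 : ℝ) ∈ Set.Ioc 0 ((m + 1) / 2) := ⟨by norm_num, by linarith⟩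
  have mh : (m + 1) / 2 ∈ Set.Ioc 0 ((m + 1) / 2) := ⟨by linarith, le_rfl⟩
  have mb : b ∈ Set.Ioc 0 ((m + 1) / 2) := ⟨hb0, hb⟩
  rcases lt_trichotomy b 1 with h | h | h
  · have := hconc.slope_anti_adjacent mb mh h (by linarith)
    rw [div_le_div_iff₀ (by linarith) (by linarith), hfh, hf1] at this
    apply mul_nonneg_of_nonpos_of_nonpos (by linarith)
    rw [← hκm] at *
    have h3 : 0 < (m - 1) / 2 := by linarith
    nlinarith
  · subst h; simp
  · rcases hb.lt_or_eq with h' | h'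
    · have := hconc.slope_anti_adjacent m1 mh h h'
      rw [div_le_div_iff₀ (by linarith) (by linarith), hfh, hf1] at this
      apply mul_nonneg (by linarith)
      rw [← hκm] at *
      have h3 : 0 < (m - 1) / 2 := by linarith
      nlinarith
    · rw [h', hfh, ← hκm]
      apply le_of_eq; ring

lemma two_value_entropy_of_le_half {m : ℝ} (hm : 2 ≤ m) {b : ℝ} (hb0 : 0 ≤ b)
    (hb : b ≤ (m + 1) / 2) :
    Real.log m / (m - 1) * (b - 1) ^ 2 ≤
      b * Real.log b + (m + 1 - b) * Real.log ((m + 1 - b) / m) := by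
  set κ := Real.log m / (m - 1) with hκ
  set F : ℝ → ℝ := fun b => b * Real.log b + (m + 1 - b) * Real.log ((m + 1 - b) / m) -
    κ * (b - 1) ^ 2 with hF
  have hd : ∀ x ∈ Set.Ioo 0 (m + 1), HasDerivAt F (Real.log x - Real.log ((m + 1 - x) / m) -
      2 * κ * (x - 1)) x := by
    intro x hx
    have hmx : m + 1 - x ≠ 0 := by linarith [hx.2]
    have hm0 : m ≠ 0 := by linarith
    have h1 := (hasDerivAt_id x).mul (Real.hasDerivAt_log (ne_of_gt hx.1))
    have h2 : HasDerivAt (fun y : ℝ => m + 1 - y) (-1) x :=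
      (hasDerivAt_id x).const_sub (m + 1)
    have h3 := h2.mul ((h2.div_const m).log (by positivity))
    have h4 := ((((hasDerivAt_id x).sub_const 1).pow 2).const_mul κ)
    refine ((h1.add h3).sub h4).congr_deriv ?_
    have := hx.1.ne'
    simp
    field_simp
    ring
  have hcont : ContinuousOn F (Set.Icc 0 ((m + 1) / 2)) := by
    have h1 : Continuous fun b : ℝ => b * Real.log b := Real.continuous_mul_log
    refine ((h1.continuousOn).add ?_).sub (by fun_prop)
    apply ContinuousOn.mul (by fun_prop)
    apply ContinuousOn.log (by fun_prop)
    intro x hx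
    have : m + 1 - x ≠ 0 := by linarith [hx.2]
    have : m ≠ 0 := by linarith
    positivity
  have hF1 : F 1 = 0 := by
    have : m ≠ 0 := by linarith
    simp [hF, this]
  suffices 0 ≤ F b by simp only [hF] at this; linarith
  rw [← hF1]
  rcases le_total b 1 with h | h
  · have : AntitoneOn F (Set.Icc 0 1) := by
      apply antitoneOn_of_deriv_nonpos (convex_Icc _ _)
      · exact hcont.mono (Set.Icc_subset_Icc le_rfl (by linarith))
      · intro x hx
        rw [interior_Icc] at hx
        exact (hd x ⟨hx.1, by linarith [hx.2]⟩).differentiableAt.differentiableWithinAt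
      · intro x hx
        rw [interior_Icc] at hx
        rw [(hd x ⟨hx.1, by linarith [hx.2]⟩).deriv]
        have := logit_tangent_sign hm hx.1 (by linarith [hx.2])
        by_contra hc
        nlinarith [hx.2]
    exact this ⟨hb0, h⟩ ⟨zero_le_one, le_rfl⟩ h
  · have : MonotoneOn F (Set.Icc 1 ((m + 1) / 2)) := by
      apply monotoneOn_of_deriv_nonneg (convex_Icc _ _)
      · exact hcont.mono (Set.Icc_subset_Icc (by norm_num) le_rfl)
      · intro x hx
        rw [interior_Icc] at hx
        exact (hd x ⟨by linarith [hx.1], by linarith [hx.2]⟩).differentiableAt.differentiableWithinAt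
      · intro x hx
        rw [interior_Icc] at hx
        rw [(hd x ⟨by linarith [hx.1], by linarith [hx.2]⟩).deriv]
        have := logit_tangent_sign hm (b := x) (by linarith [hx.1]) (by linarith [hx.2])
        by_contra hc
        nlinarith [hx.1]
    exact this ⟨le_rfl, by linarith⟩ ⟨h, hb⟩ h

lemma two_value_entropy {m : ℝ} (hm : 2 ≤ m) {b : ℝ} (hb0 : 0 ≤ b) (hb : b ≤ m + 1) :
    Real.log m / (m - 1) * (b - 1) ^ 2 ≤
      b * Real.log b + (m + 1 - b) * Real.log ((m + 1 - b) / m) := by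
  rcases le_total b ((m + 1) / 2) with h | h
  · exact two_value_entropy_of_le_half hm hb0 h
  · have key := two_value_entropy_of_le_half hm (b := m + 1 - b) (by linarith) (by linarith)
    have hm1 : m - 1 ≠ 0 := by linarith
    have e : ∀ z, z * Real.log (z / m) = z * Real.log z - z * Real.log m := by
      intro z
      rcases eq_or_ne z 0 with rfl | hz
      · simp
      · rw [Real.log_div hz (by linarith)]; ring
    rw [e] at key ⊢
    have hκm : Real.log m / (m - 1) * (m - 1) = Real.log m := by field_simp
    set κ := Real.log m / (m - 1)
    rw [show m + 1 - (m + 1 - b) = b by ring] at key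
    rw [← hκm] at key ⊢
    nlinarith

lemma hasDerivAt_mul_log_sub_sq (c : ℝ) {x : ℝ} (hx : 0 < x) :
    HasDerivAt (fun x => x * Real.log x - c * x ^ 2) (Real.log x + 1 - 2 * c * x) x := by
  refine ((Real.hasDerivAt_mul_log hx.ne').sub ((hasDerivAt_pow 2 x).const_mul c)).congr_deriv ?_
  simp; ring

lemma hasDerivAt_log_sub_linear (c : ℝ) {x : ℝ} (hx : 0 < x) :
    HasDerivAt (fun y => Real.log y + 1 - 2 * c * y) (x⁻¹ - 2 * c) x := by
  refine (((Real.hasDerivAt_log hx.ne').add_const 1).sub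
    ((hasDerivAt_id x).const_mul (2 * c))).congr_deriv ?_
  simp

lemma convexOn_mul_log_sub_sq {c : ℝ} (hc : 0 < c) :
    ConvexOn ℝ (Set.Icc 0 (1 / (2 * c))) fun x => x * Real.log x - c * x ^ 2 := by
  apply convexOn_of_hasDerivWithinAt2_nonneg (convex_Icc _ _)
    (Real.continuous_mul_log.sub (by fun_prop)).continuousOn
    (f' := fun y => Real.log y + 1 - 2 * c * y) (f'' := fun x => x⁻¹ - 2 * c)
  all_goals
    intro x hx
    rw [interior_Icc] at hx
  · exact (hasDerivAt_mul_log_sub_sq c hx.1).hasDerivWithinAt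
  · exact (hasDerivAt_log_sub_linear c hx.1).hasDerivWithinAt
  · rw [inv_eq_one_div, sub_nonneg, le_div_iff₀ hx.1]
    have := hx.2.le
    rw [le_div_iff₀ (by positivity)] at this
    linarith

lemma strictConcaveOn_mul_log_sub_sq {c : ℝ} (hc : 0 < c) :
    StrictConcaveOn ℝ (Set.Ici (1 / (2 * c))) fun x => x * Real.log x - c * x ^ 2 := by
  apply strictConcaveOn_of_deriv2_neg (convex_Ici _)
  · exact (Real.continuous_mul_log.sub (by fun_prop)).continuousOn
  · intro x hx
    rw [interior_Ici] at hx
    have h0 : 0 < 1 / (2 * c) := by positivity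
    have hx0 : 0 < x := h0.trans hx
    have h2 : deriv (fun x => x * Real.log x - c * x ^ 2) =ᶠ[𝓝 x]
        fun y => Real.log y + 1 - 2 * c * y := by
      filter_upwards [eventually_gt_nhds hx0] with y hy
        using (hasDerivAt_mul_log_sub_sq c hy).deriv
    have h3 : deriv^[2] (fun x => x * Real.log x - c * x ^ 2) x = x⁻¹ - 2 * c := by
      simpa using h2.deriv_eq.trans (hasDerivAt_log_sub_linear c hx0).deriv
    rw [h3, inv_eq_one_div, sub_neg, div_lt_iff₀ hx0]
    have := hx.out
    rw [div_lt_iff₀ (by positivity)] at this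
    linarith

lemma eq_of_lt_of_min_sum {ι : Type*} [Fintype ι] {s M : ℝ} (hs : 0 ≤ s) {ψ : ℝ → ℝ}
    (hψ : StrictConcaveOn ℝ (Set.Ici s) ψ) {y : ι → ℝ} (hy0 : ∀ i, 0 ≤ y i)
    (hyM : ∑ i, y i = M)
    (hmin : ∀ z : ι → ℝ, (∀ i, 0 ≤ z i) → ∑ i, z i = M → ∑ i, ψ (y i) ≤ ∑ i, ψ (z i))
    {i j : ι} (hi : s < y i) (hj : s < y j) : i = j := by
  classical
  by_contra hij
  obtain ⟨δ, hδ, hδi, hδj⟩ : ∃ δ : ℝ, 0 < δ ∧ s ≤ y i - δ ∧ s ≤ y j - δ :=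
    ⟨min (y i - s) (y j - s), by simp [hi, hj], by linarith [min_le_left (y i - s) (y j - s)],
      by linarith [min_le_right (y i - s) (y j - s)]⟩
  set d : ι → ℝ := fun k => (if k = i then δ else 0) - (if k = j then δ else 0) with hd
  have hdsum : ∑ k, d k = 0 := by simp [hd]
  have hdi : d i = δ := by simp [hd, hij]
  have hdj : d j = -δ := by simp [hd, Ne.symm hij]
  have hdk : ∀ k, k ≠ i → k ≠ j → d k = 0 := by intro k h1 h2; simp [hd, h1, h2]
  have hmid : ∀ x, s ≤ x - δ → ψ (x + δ) + ψ (x - δ) < 2 * ψ x := by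
    intro x hx
    have := hψ.2 (show x + δ ∈ Set.Ici s by simp; linarith)
      (show x - δ ∈ Set.Ici s by simpa using hx) (by linarith)
      (show (0 : ℝ) < 1 / 2 by norm_num) (show (0 : ℝ) < 1 / 2 by norm_num) (by norm_num)
    simp only [smul_eq_mul] at this
    rw [show 1 / 2 * (x + δ) + 1 / 2 * (x - δ) = x by ring] at this
    linarith
  have h1 := hmin (fun k => y k + d k) (fun k => by
    by_cases hki : k = i
    · subst hki; rw [hdi]; linarith
    by_cases hkj : k = j
    · subst hkj; rw [hdj]; linarith
    rw [hdk k hki hkj]; simpa using hy0 k) (by rw [Finset.sum_add_distrib, hdsum, hyM, add_zero])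
  have h2 := hmin (fun k => y k - d k) (fun k => by
    by_cases hki : k = i
    · subst hki; rw [hdi]; linarith
    by_cases hkj : k = j
    · subst hkj; rw [hdj]; linarith
    rw [hdk k hki hkj]; simpa using hy0 k) (by rw [Finset.sum_sub_distrib, hdsum, hyM, sub_zero])
  have h3 : ∑ k, (ψ (y k + d k) + ψ (y k - d k)) < ∑ k, 2 * ψ (y k) := by
    apply Finset.sum_lt_sum
    · intro k _
      by_cases hki : k = i
      · subst hki; rw [hdi]; exact (hmid _ hδi).le
      by_cases hkj : k = j
      · subst hkj; rw [hdj, sub_neg_eq_add, ← sub_eq_add_neg, add_comm]; exact (hmid _ hδj).le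
      rw [hdk k hki hkj]; simp [two_mul]
    · exact ⟨i, Finset.mem_univ _, by rw [hdi]; exact hmid _ hδi⟩
  rw [Finset.sum_add_distrib, ← Finset.mul_sum] at h3
  linarith

lemma exists_min_sum_simplex {ι : Type*} [Fintype ι] [Nonempty ι] {M : ℝ} (hM : 0 ≤ M) {ψ : ℝ → ℝ}
    (hψ : Continuous ψ) : ∃ y : ι → ℝ, (∀ i, 0 ≤ y i) ∧ ∑ i, y i = M ∧
      ∀ z : ι → ℝ, (∀ i, 0 ≤ z i) → ∑ i, z i = M → ∑ i, ψ (y i) ≤ ∑ i, ψ (z i) := by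
  classical
  set S : Set (ι → ℝ) := {y | (∀ i, 0 ≤ y i) ∧ ∑ i, y i = M} with hS
  have hcomp : IsCompact S := by
    apply IsCompact.of_isClosed_subset (isCompact_Icc (a := fun _ : ι => (0 : ℝ)) (b := fun _ => M))
    · rw [hS]
      apply IsClosed.inter
      · exact isClosed_le (continuous_const (y := (0 : ι → ℝ))) continuous_id
      · exact isClosed_eq (by fun_prop) continuous_const
    · rintro y ⟨h0, h1⟩
      exact ⟨h0, fun i => h1 ▸ Finset.single_le_sum (fun k _ => h0 k) (Finset.mem_univ i)⟩
  have hne : S.Nonempty := by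
    obtain ⟨i⟩ := ‹Nonempty ι›
    refine ⟨fun k => if k = i then M else 0, fun k => ?_, by simp⟩
    dsimp only; split_ifs <;> simp [hM]
  obtain ⟨y, hy, hmin⟩ := hcomp.exists_isMinOn hne (f := fun y => ∑ i, ψ (y i)) (by fun_prop)
  exact ⟨y, hy.1, hy.2, fun z h0 h1 => hmin ⟨h0, h1⟩⟩

lemma sum_mul_log_ge {ι : Type*} [Fintype ι] {L c : ℝ} (hL : 3 ≤ L)
    (hcard : (Fintype.card ι : ℝ) = L)
    (hc : c = (L - 1) * Real.log (L - 1) / (L * (L - 2)))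
    {z : ι → ℝ} (hz0 : ∀ i, 0 ≤ z i) (hz : ∑ i, z i = L) :
    c * (∑ i, z i ^ 2 - L) ≤ ∑ i, z i * Real.log (z i) := by
  classical
  have hne : Nonempty ι := by
    by_contra h
    rw [not_nonempty_iff] at h
    simp at hcard; linarith
  have hlog : 0 < Real.log (L - 1) := Real.log_pos (by linarith)
  have hL1 : 0 < L - 1 := by linarith
  have hL2 : 0 < L - 2 := by linarith
  have hc0 : 0 < c := by rw [hc]; positivity
  set ψ : ℝ → ℝ := fun x => x * Real.log x - c * x ^ 2 with hψ
  obtain ⟨y, hy0, hy, hmin⟩ := exists_min_sum_simplex (ι := ι) (M := L) (by linarith)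
    (ψ := ψ) (Real.continuous_mul_log.sub (by fun_prop))
  have hs : 0 ≤ 1 / (2 * c) := by positivity
  obtain ⟨i, hi⟩ : ∃ i, ∀ j ∈ Finset.univ.erase i, y j ≤ 1 / (2 * c) := by
    by_cases h : ∃ i, 1 / (2 * c) < y i
    · obtain ⟨i, hi⟩ := h
      refine ⟨i, fun j hj => ?_⟩
      by_contra hj'
      exact (Finset.ne_of_mem_erase hj)
        (eq_of_lt_of_min_sum hs (strictConcaveOn_mul_log_sub_sq hc0) hy0 hy hmin
          (not_le.mp hj') hi)
    · push Not at h
      exact ⟨Classical.arbitrary ι, fun j _ => h j⟩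
  have hcarde : ((Finset.univ.erase i).card : ℝ) = L - 1 := by
    rw [Finset.card_erase_of_mem (Finset.mem_univ i), Nat.cast_sub, Finset.card_univ, hcard]
    · simp
    · exact Finset.card_pos.mpr ⟨i, Finset.mem_univ i⟩
  have hrest : ∑ j ∈ Finset.univ.erase i, y j = L - y i := by
    rw [← hy, ← Finset.add_sum_erase _ y (Finset.mem_univ i)]; ring
  have hjen := (convexOn_mul_log_sub_sq hc0).map_sum_le (t := Finset.univ.erase i)
    (w := fun _ => 1 / (L - 1)) (p := y) (fun _ _ => by positivity)
    (by rw [Finset.sum_const, nsmul_eq_mul, hcarde]; field_simp)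
    (fun j hj => ⟨hy0 j, hi j hj⟩)
  simp only [smul_eq_mul] at hjen
  rw [← Finset.mul_sum, ← Finset.mul_sum, hrest] at hjen
  have hb1 : y i ≤ L := by
    have : 0 ≤ ∑ j ∈ Finset.univ.erase i, y j := Finset.sum_nonneg fun j _ => hy0 j
    linarith
  have htwo := two_value_entropy (m := L - 1) (by linarith) (hy0 i) (by linarith)
  have htot : ψ (y i) + ∑ j ∈ Finset.univ.erase i, ψ (y j) = ∑ j, ψ (y j) :=
    Finset.add_sum_erase _ (fun j => ψ (y j)) (Finset.mem_univ i)
  have hle := hmin z hz0 hz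
  have hzs : ∑ j, ψ (z j) = ∑ j, z j * Real.log (z j) - c * ∑ j, z j ^ 2 := by
    simp only [hψ]; rw [Finset.sum_sub_distrib, Finset.mul_sum]
  have hjen' : (L - y i) * Real.log ((L - y i) / (L - 1)) - c * (L - y i) ^ 2 / (L - 1) ≤
      ∑ j ∈ Finset.univ.erase i, ψ (y j) := by
    have := mul_le_mul_of_nonneg_left hjen hL1.le
    rw [← mul_assoc (L - 1) (1 / (L - 1)) (∑ j ∈ _, _), mul_one_div_cancel hL1.ne', one_mul] at this
    refine le_trans (le_of_eq ?_) this
    rw [show 1 / (L - 1) * (L - y i) = (L - y i) / (L - 1) by ring]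
    field_simp
  have hcm : Real.log (L - 1) = c * L * (L - 2) / (L - 1) := by
    rw [hc]; field_simp
  rw [show L - 1 + 1 = L by ring, show L - 1 - 1 = L - 2 by ring] at htwo
  have hquad : Real.log (L - 1) / (L - 2) * (y i - 1) ^ 2 =
      c * (y i ^ 2 + (L - y i) ^ 2 / (L - 1) - L) := by
    rw [hcm]; field_simp; ring
  rw [hquad] at htwo
  have e : c * (L - y i) ^ 2 / (L - 1) = c * ((L - y i) ^ 2 / (L - 1)) := by ring
  rw [e] at hjen'
  have : ψ (y i) = y i * Real.log (y i) - c * y i ^ 2 := rfl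
  linarith

/-- Sharp sub-Gaussian bound for the uniform distribution on the vertices of a simplex. -/
lemma sum_exp_le {ι : Type*} [Fintype ι] {L c : ℝ} (hL : 3 ≤ L)
    (hcard : (Fintype.card ι : ℝ) = L)
    (hc : c = (L - 1) * Real.log (L - 1) / (L * (L - 2))) (t : ι → ℝ) :
    1 / L * ∑ i, Real.exp (t i) ≤
      Real.exp ((∑ i, t i) / L + (∑ i, t i ^ 2) / (4 * c * L)) := by
  have hne : Nonempty ι := by
    by_contra h
    rw [not_nonempty_iff] at h
    simp at hcard; linarith
  have hlog : 0 < Real.log (L - 1) := Real.log_pos (by linarith)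
  have hL1 : 0 < L - 1 := by linarith
  have hL2 : 0 < L - 2 := by linarith
  have hL0 : 0 < L := by linarith
  have hc0 : 0 < c := by rw [hc]; positivity
  set Z := 1 / L * ∑ i, Real.exp (t i) with hZ
  have hZ0 : 0 < Z := by
    have : 0 < ∑ i, Real.exp (t i) :=
      Finset.sum_pos (fun i _ => Real.exp_pos _) Finset.univ_nonempty
    positivity
  have hsum : ∑ i, Real.exp (t i) / Z = L := by
    rw [← Finset.sum_div, hZ]
    have : ∑ i, Real.exp (t i) ≠ 0 :=
      (Finset.sum_pos (fun i _ => Real.exp_pos _) Finset.univ_nonempty).ne'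
    field_simp
  have key := sum_mul_log_ge hL hcard hc (z := fun i => Real.exp (t i) / Z)
    (fun i => by positivity) hsum
  set z : ι → ℝ := fun i => Real.exp (t i) / Z with hz
  have hzlog : ∀ i, Real.log (z i) = t i - Real.log Z := by
    intro i; rw [hz, Real.log_div (Real.exp_pos _).ne' hZ0.ne', Real.log_exp]
  have hent : ∑ i, z i * Real.log (z i) = ∑ i, z i * t i - L * Real.log Z := by
    rw [← hsum, Finset.sum_mul, ← Finset.sum_sub_distrib]
    exact Finset.sum_congr rfl fun i _ => by rw [hzlog]; ring
  have hsq : ∑ i, (z i * t i - c * z i ^ 2) + c * L ≤ ∑ i, t i + (∑ i, t i ^ 2) / (4 * c) := by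
    have h1 : ∀ i, z i * t i - c * z i ^ 2 ≤ t i + t i ^ 2 / (4 * c) - 2 * c * z i + c := by
      intro i
      have h2 : t i ^ 2 / (4 * c) - (z i - 1) * t i + c * (z i - 1) ^ 2 =
          (t i - 2 * c * (z i - 1)) ^ 2 / (4 * c) := by field_simp; ring
      have h3 : 0 ≤ (t i - 2 * c * (z i - 1)) ^ 2 / (4 * c) := by positivity
      linarith
    have h4 := Finset.sum_le_sum fun i (_ : i ∈ Finset.univ) => h1 i
    have h5 : ∑ i, (t i + t i ^ 2 / (4 * c) - 2 * c * z i + c) =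
        ∑ i, t i + (∑ i, t i ^ 2) / (4 * c) - 2 * c * L + L * c := by
      rw [Finset.sum_add_distrib, Finset.sum_sub_distrib, Finset.sum_add_distrib,
        ← Finset.mul_sum, ← Finset.sum_div, Finset.sum_const, Finset.card_univ, nsmul_eq_mul,
        hcard, hsum]
    linarith
  rw [Finset.sum_sub_distrib, ← Finset.mul_sum] at hsq
  rw [← Real.log_le_iff_le_exp hZ0]
  have h5 : L * Real.log Z ≤ ∑ i, t i + (∑ i, t i ^ 2) / (4 * c) := by
    linarith
  have h6 : (∑ i, t i) / L + (∑ i, t i ^ 2) / (4 * c * L) =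
      (∑ i, t i + (∑ i, t i ^ 2) / (4 * c)) / L := by field_simp
  rw [h6, le_div_iff₀ hL0]
  linarith

lemma integrable_exp_mul_sq_gaussianReal {θ : ℝ} (hθ : θ < 1 / 2) :
    Integrable (fun z => Real.exp (θ * z ^ 2)) (ProbabilityTheory.gaussianReal 0 1) := by
  rw [ProbabilityTheory.gaussianReal_of_var_ne_zero _ one_ne_zero,
    integrable_withDensity_iff_integrable_smul'
      (ProbabilityTheory.measurable_gaussianPDF 0 1)
      (ae_of_all _ fun _ => ProbabilityTheory.gaussianPDF_lt_top)]
  have := (integrable_exp_neg_mul_sq (b := 1 / 2 - θ) (by linarith)).const_mul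
    (√(2 * Real.pi))⁻¹
  refine this.congr (Eventually.of_forall fun z => ?_)
  simp only [ProbabilityTheory.toReal_gaussianPDF, ProbabilityTheory.gaussianPDFReal, smul_eq_mul,
    NNReal.coe_one, mul_one, sub_zero, mul_assoc]
  rw [← Real.exp_add]
  congr 2
  ring

lemma integral_exp_mul_gaussianReal (t : ℝ) :
    ∫ z, Real.exp (t * z) ∂(ProbabilityTheory.gaussianReal 0 1) = Real.exp (t ^ 2 / 2) := by
  have := congrFun (ProbabilityTheory.mgf_id_gaussianReal (μ := 0) (v := 1)) t
  simpa [ProbabilityTheory.mgf] using this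

open Classical in
lemma sum_mul_centered_count {ι : Type*} [Fintype ι] {L : ℝ} {n : ℕ}
    (x : Fin n → ι) (t : ι → ℝ) :
    ∑ a, t a * ∑ u, ((if x u = a then 1 else 0) - 1 / L) =
      ∑ u, (t (x u) - (∑ a, t a) / L) := by
  simp_rw [Finset.mul_sum]
  rw [Finset.sum_comm]
  refine Finset.sum_congr rfl fun u _ => ?_
  simp_rw [mul_sub]
  rw [Finset.sum_sub_distrib, ← Finset.sum_mul]
  simp
  ring

open Classical in
lemma exp_sq_centered_count_le {ι : Type*} [Fintype ι] {L c lam : ℝ} (hL : 3 ≤ L)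
    (hcard : (Fintype.card ι : ℝ) = L)
    (hc : c = (L - 1) * Real.log (L - 1) / (L * (L - 2))) (h0 : 0 ≤ lam) (hlam : lam < c)
    {n : ℕ} (hn : 0 < n) :
    (1 / L) ^ n * ∑ x : Fin n → ι, Real.exp (lam * L / n *
        ∑ a, (∑ u, ((if x u = a then 1 else 0) - 1 / L)) ^ 2) ≤
      ∏ _a : ι, ∫ z, Real.exp (lam / (2 * c) * z ^ 2) ∂(ProbabilityTheory.gaussianReal 0 1) := by
  have hc0 : 0 < c := h0.trans_lt hlam
  have hL0 : 0 < L := by linarith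
  have hn0 : (0 : ℝ) < n := by exact_mod_cast hn
  set γ := ProbabilityTheory.gaussianReal 0 1
  set S : (Fin n → ι) → ι → ℝ := fun x a => ∑ u, ((if x u = a then 1 else 0) - 1 / L) with hS
  set τ := √(2 * (lam * L / n)) with hτ
  have hτ2 : τ ^ 2 = 2 * (lam * L / n) := Real.sq_sqrt (by positivity)
  have hint : ∀ x, Integrable (fun z : ι → ℝ => ∏ a, Real.exp (τ * S x a * z a))
      (Measure.pi fun _ : ι => γ) := fun x =>
    Integrable.fintype_prod (f := fun a z => Real.exp (τ * S x a * z)) fun a =>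
      ProbabilityTheory.integrable_exp_mul_gaussianReal _
  have hrep : ∀ x, Real.exp (lam * L / n * ∑ a, S x a ^ 2) =
      ∫ z : ι → ℝ, ∏ a, Real.exp (τ * S x a * z a) ∂(Measure.pi fun _ : ι => γ) := by
    intro x
    rw [integral_fintype_prod_eq_prod (f := fun a z => Real.exp (τ * S x a * z)), Finset.mul_sum,
      Real.exp_sum]
    refine Finset.prod_congr rfl fun a _ => ?_
    rw [integral_exp_mul_gaussianReal, mul_pow, hτ2]
    congr 1; ring
  have hθ : lam / (2 * c) < 1 / 2 := by
    rw [div_lt_div_iff₀ (by positivity) (by norm_num)]; linarith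
  have hint2 : Integrable (fun z : ι → ℝ => ∏ a, Real.exp (lam / (2 * c) * z a ^ 2))
      (Measure.pi fun _ : ι => γ) :=
    Integrable.fintype_prod (f := fun _ z => Real.exp (lam / (2 * c) * z ^ 2)) fun a =>
      integrable_exp_mul_sq_gaussianReal hθ
  calc (1 / L) ^ n * ∑ x, Real.exp (lam * L / n * ∑ a, S x a ^ 2)
      = ∫ z : ι → ℝ, (1 / L) ^ n * ∑ x, ∏ a, Real.exp (τ * S x a * z a)
          ∂(Measure.pi fun _ : ι => γ) := by
        rw [integral_const_mul, integral_finsetSum _ fun x _ => hint x]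
        simp_rw [hrep]
    _ ≤ ∫ z : ι → ℝ, ∏ a, Real.exp (lam / (2 * c) * z a ^ 2) ∂(Measure.pi fun _ : ι => γ) := by
        refine integral_mono ((integrable_finsetSum _ fun x _ => hint x).const_mul _) hint2
          fun z => ?_
        dsimp only
        set m := (∑ a, τ * z a) / L
        have h1 : ∀ x, ∏ a, Real.exp (τ * S x a * z a) = ∏ u, Real.exp (τ * z (x u) - m) := by
          intro x
          rw [← Real.exp_sum, ← Real.exp_sum, ← sum_mul_centered_count x fun a => τ * z a]
          congr 1
          exact Finset.sum_congr rfl fun a _ => by ring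
        simp_rw [h1]
        rw [← Fintype.sum_pow (fun a => Real.exp (τ * z a - m)), ← mul_pow, ← Real.exp_sum]
        have h2 : 1 / L * ∑ a, Real.exp (τ * z a - m) ≤
            Real.exp ((∑ a, (τ * z a) ^ 2) / (4 * c * L)) := by
          have h3 := sum_exp_le hL hcard hc fun a => τ * z a
          rw [Real.exp_add] at h3
          simp_rw [Real.exp_sub]
          rw [← Finset.sum_div, ← mul_div_assoc, div_le_iff₀ (Real.exp_pos _)]
          linarith
        have hpos : 0 ≤ 1 / L * ∑ a, Real.exp (τ * z a - m) :=
          mul_nonneg (by positivity) (Finset.sum_nonneg fun _ _ => (Real.exp_pos _).le)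
        refine (pow_le_pow_left₀ hpos h2 n).trans (le_of_eq ?_)
        rw [← Real.exp_nat_mul]
        congr 1
        simp_rw [mul_pow]
        rw [← Finset.mul_sum, ← Finset.mul_sum, hτ2]
        field_simp
        ring
    _ = ∏ _a : ι, ∫ z, Real.exp (lam / (2 * c) * z ^ 2) ∂γ :=
        integral_fintype_prod_eq_prod (f := fun _ z => Real.exp (lam / (2 * c) * z ^ 2))

open Classical in
lemma sum_sq_centered_count {ι : Type*} [Fintype ι] {L : ℝ} (hL0 : L ≠ 0)
    (hcard : (Fintype.card ι : ℝ) = L) {n : ℕ} (x : Fin n → ι) :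
    L * ∑ a, (∑ u, ((if x u = a then 1 else 0) - 1 / L)) ^ 2 =
      ∑ u, ∑ v, (L * (if x u = x v then 1 else 0) - 1) := by
  simp_rw [sq, Finset.sum_mul_sum]
  rw [Finset.sum_comm, Finset.mul_sum]
  refine Finset.sum_congr rfl fun u _ => ?_
  rw [Finset.sum_comm, Finset.mul_sum]
  refine Finset.sum_congr rfl fun v _ => ?_
  simp_rw [sub_mul, mul_sub, Finset.sum_sub_distrib, ← Finset.mul_sum, ← Finset.sum_mul]
  simp [hcard, Finset.card_univ]
  split_ifs
  all_goals field_simp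
  all_goals ring

lemma sum_pairs_eq {n : ℕ} (f : Fin n → Fin n → ℝ) (hf : ∀ u v, f u v = f v u) :
    ∑ u, ∑ v, f u v = 2 * (∑ q : {q : Fin n × Fin n // q.1 < q.2}, f q.1.1 q.1.2) + ∑ u, f u u := by
  have h1 : ∑ q : {q : Fin n × Fin n // q.1 < q.2}, f q.1.1 q.1.2 =
      ∑ u, ∑ v, if u < v then f u v else 0 := by
    rw [← Finset.sum_product', Finset.univ_product_univ, ← Finset.sum_filter]
    exact (Finset.sum_subtype _ (by simp) fun q : Fin n × Fin n => f q.1 q.2).symm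
  have h2 : ∑ u, ∑ v, (if u < v then f u v else 0) = ∑ u, ∑ v, if v < u then f u v else 0 := by
    rw [Finset.sum_comm]
    exact Finset.sum_congr rfl fun u _ => Finset.sum_congr rfl fun v _ => by rw [hf]
  have h3 : ∑ u, f u u = ∑ u, ∑ v, if u = v then f u v else 0 := by simp
  rw [two_mul, h1]
  nth_rewrite 2 [h2]
  rw [h3, ← Finset.sum_add_distrib, ← Finset.sum_add_distrib]
  refine Finset.sum_congr rfl fun u _ => ?_
  rw [← Finset.sum_add_distrib, ← Finset.sum_add_distrib]
  refine Finset.sum_congr rfl fun v _ => ?_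
  rcases lt_trichotomy u v with h | h | h
  · simp [h, h.ne, h.not_gt]
  · simp [h]
  · simp [h, h.ne', h.not_gt]

open Classical in
/-- The probability mass function of a truth-or-Haar edge observation. -/
noncomputable def tohWeight {G : Type*} [Fintype G] (p : ℝ) (y a : G) : ℝ :=
  p * (if a = y then 1 else 0) + (1 - p) / Fintype.card G

lemma tohWeight_nonneg {G : Type*} [Fintype G] {p : ℝ} (hp0 : 0 ≤ p) (hp1 : p ≤ 1) (y a : G) :
    0 ≤ tohWeight p y a := by
  unfold tohWeight
  have : 0 ≤ 1 - p := by linarith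
  positivity

lemma uniformG_eq_sum_dirac (G : Type*) [Fintype G] [Nonempty G] [MeasurableSpace G] :
    uniformG G = ∑ a : G, ENNReal.ofReal (1 / Fintype.card G) • Measure.dirac a := by
  ext s hs
  have hc : ENNReal.ofReal (1 / (Fintype.card G : ℝ)) = (Fintype.card G : ℝ≥0∞)⁻¹ := by
    rw [one_div, ENNReal.ofReal_inv_of_pos (by exact_mod_cast Fintype.card_pos),
      ENNReal.ofReal_natCast]
  rw [uniformG, PMF.toMeasure_apply _ hs, tsum_fintype, Measure.finsetSum_apply]
  refine Finset.sum_congr rfl fun a _ => ?_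
  rw [Measure.smul_apply, Measure.dirac_apply' _ hs, hc]
  by_cases h : a ∈ s <;> simp [h]

lemma tohEdge_eq_sum_dirac {G : Type*} [Fintype G] [Nonempty G] [MeasurableSpace G]
    {p : ℝ} (hp0 : 0 ≤ p) (hp1 : p ≤ 1) (y : G) :
    tohEdge p y = ∑ a : G, ENNReal.ofReal (tohWeight p y a) • Measure.dirac a := by
  classical
  have hp1' : 0 ≤ 1 - p := by linarith
  have h1 : ∀ a, ENNReal.ofReal (tohWeight p y a) =
      ENNReal.ofReal p * (if a = y then 1 else 0) +
        ENNReal.ofReal (1 - p) * ENNReal.ofReal (1 / Fintype.card G) := by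
    intro a
    rw [tohWeight, ENNReal.ofReal_add (by positivity) (by positivity),
      ENNReal.ofReal_mul hp0, ← ENNReal.ofReal_mul hp1']
    congr 2
    · split_ifs <;> simp
    · ring
  simp_rw [h1, add_smul, Finset.sum_add_distrib, mul_smul]
  rw [← Finset.smul_sum, ← Finset.smul_sum, ← uniformG_eq_sum_dirac]
  unfold tohEdge
  congr 2
  simp

lemma measure_pi_sum_smul_dirac {ι G : Type*} [Fintype ι] [DecidableEq ι] [Fintype G] [MeasurableSpace G]
    (c : ι → G → ℝ≥0∞) (hc : ∀ i a, c i a ≠ ∞) :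
    Measure.pi (fun i => ∑ a, c i a • Measure.dirac a) =
      ∑ f : ι → G, (∏ i, c i (f i)) • Measure.dirac f := by
  classical
  have hfin : ∀ i, IsFiniteMeasure (∑ a, c i a • (Measure.dirac a : Measure G)) := fun i => by
    constructor
    rw [Measure.finsetSum_apply]
    refine ENNReal.sum_lt_top.mpr fun a _ => ?_
    simpa using (hc i a).lt_top
  refine Measure.pi_eq fun s hs => ?_
  simp_rw [Measure.finsetSum_apply, Measure.smul_apply,
    Measure.dirac_apply' _ (MeasurableSet.univ_pi hs)]
  simp_rw [Measure.dirac_apply' _ (hs _)]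
  rw [Finset.prod_univ_sum, Fintype.piFinset_univ]
  refine Finset.sum_congr rfl fun f _ => ?_
  simp only [smul_eq_mul]
  rw [Finset.prod_mul_distrib]
  congr 1
  by_cases h : ∀ i, f i ∈ s i
  · simp [Set.indicator, h]
  · rw [Set.indicator_of_notMem (by simpa using h)]
    push Not at h
    obtain ⟨i, hi⟩ := h
    exact (Finset.prod_eq_zero (Finset.mem_univ i) (by simp [hi])).symm

lemma lintegral_sum_smul_dirac_le {α : Type*} [Fintype α] [MeasurableSpace α]
    (c : α → ℝ≥0∞) (f : α → ℝ≥0∞) :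
    ∫⁻ a, f a ∂(∑ a, c a • Measure.dirac a) ≤ ∑ a, c a * f a := by
  obtain ⟨φ, hφ, hle, heq⟩ := exists_measurable_le_lintegral_eq
    (μ := ∑ a, c a • Measure.dirac a) f
  rw [heq, lintegral_finsetSum_measure]
  refine Finset.sum_le_sum fun a _ => ?_
  rw [lintegral_smul_measure, lintegral_dirac' _ hφ, smul_eq_mul]
  exact mul_le_mul_right (hle a) _

/-- The probability mass function of the spiked truth-or-Haar array. -/
noncomputable def tohMass (G : Type*) [Group G] [Fintype G] (n : ℕ) (p : ℝ)
    (Y : {q : Fin n × Fin n // q.1 < q.2} → G) : ℝ :=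
  (1 / (Fintype.card G : ℝ)) ^ n *
    ∑ g : Fin n → G, ∏ q : {q : Fin n × Fin n // q.1 < q.2},
      tohWeight p (g q.1.1 * (g q.1.2)⁻¹) (Y q)

lemma tohMass_nonneg {G : Type*} [Group G] [Fintype G] {n : ℕ} {p : ℝ} (hp0 : 0 ≤ p) (hp1 : p ≤ 1)
    (Y : {q : Fin n × Fin n // q.1 < q.2} → G) : 0 ≤ tohMass G n p Y :=
  mul_nonneg (by positivity) (Finset.sum_nonneg fun _ _ =>
    Finset.prod_nonneg fun _ _ => tohWeight_nonneg hp0 hp1 _ _)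

open Classical in
lemma tohSpiked_apply_le {G : Type*} [Group G] [Fintype G] [Nonempty G] [MeasurableSpace G]
    {n : ℕ} {pt : ℝ} (hp0 : 0 ≤ pt / √n) (hp1 : pt / √n ≤ 1)
    {A : Set ({q : Fin n × Fin n // q.1 < q.2} → G)} (hA : MeasurableSet A) :
    tohSpiked G n pt A ≤ ENNReal.ofReal (∑ Y with Y ∈ A, tohMass G n (pt / √n) Y) := by
  set p := pt / √n with hp
  refine (Measure.bind_apply_le _ hA).trans ?_
  rw [uniformG_eq_sum_dirac, measure_pi_sum_smul_dirac _ (by simp)]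
  refine (lintegral_sum_smul_dirac_le _ _).trans (le_of_eq ?_)
  simp_rw [← hp, tohEdge_eq_sum_dirac hp0 hp1]
  have h1 : ∀ g : Fin n → G, Measure.pi (fun q : {q : Fin n × Fin n // q.1 < q.2} =>
      ∑ a, ENNReal.ofReal (tohWeight p (g q.1.1 * (g q.1.2)⁻¹) a) • Measure.dirac a) A =
      ENNReal.ofReal (∑ Y with Y ∈ A, ∏ q : {q : Fin n × Fin n // q.1 < q.2},
        tohWeight p (g q.1.1 * (g q.1.2)⁻¹) (Y q)) := by
    intro g
    rw [measure_pi_sum_smul_dirac _ (by simp), Measure.finsetSum_apply, Finset.sum_filter,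
      ENNReal.ofReal_sum_of_nonneg]
    · refine Finset.sum_congr rfl fun Y _ => ?_
      rw [Measure.smul_apply, Measure.dirac_apply' _ hA]
      split_ifs with h
      · simp [h, ENNReal.ofReal_prod_of_nonneg fun _ _ => tohWeight_nonneg hp0 hp1 _ _]
      · simp [h]
    · intro Y _
      split_ifs
      · exact Finset.prod_nonneg fun _ _ => tohWeight_nonneg hp0 hp1 _ _
      · exact le_rfl
  simp_rw [h1]
  simp only [Finset.prod_const, Finset.card_univ, Fintype.card_fin]
  rw [← Finset.mul_sum, ← ENNReal.ofReal_pow (by positivity), ← ENNReal.ofReal_sum_of_nonneg,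
    ← ENNReal.ofReal_mul (by positivity)]
  · simp only [tohMass]
    rw [← Finset.mul_sum, Finset.sum_comm]
  · exact fun g _ => Finset.sum_nonneg fun _ _ =>
      Finset.prod_nonneg fun _ _ => tohWeight_nonneg hp0 hp1 _ _

open Classical in
lemma tohUnspiked_apply {G : Type*} [Fintype G] [Nonempty G] [MeasurableSpace G]
    {n : ℕ} {A : Set ({q : Fin n × Fin n // q.1 < q.2} → G)} (hA : MeasurableSet A) :
    (tohUnspiked G n A).toReal = (Finset.univ.filter (· ∈ A)).card *
      (1 / (Fintype.card G : ℝ)) ^ Fintype.card {q : Fin n × Fin n // q.1 < q.2} := by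
  rw [tohUnspiked, uniformG_eq_sum_dirac, measure_pi_sum_smul_dirac _ (by simp),
    Measure.finsetSum_apply]
  simp_rw [Measure.smul_apply, Measure.dirac_apply' _ hA]
  simp only [Finset.prod_const, Finset.card_univ, smul_eq_mul]
  rw [← Finset.mul_sum, ENNReal.toReal_mul, ENNReal.toReal_pow,
    ENNReal.toReal_ofReal (by positivity), mul_comm]
  congr 1
  simp [Set.indicator]

open Classical in
lemma sum_tohWeight_mul {G : Type*} [Fintype G] [Nonempty G] (p : ℝ) (y z : G) :
    Fintype.card G * ∑ a, tohWeight p y a * tohWeight p z a =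
      1 + p ^ 2 * (Fintype.card G * (if y = z then 1 else 0) - 1) := by
  have hL : (Fintype.card G : ℝ) ≠ 0 := by exact_mod_cast Fintype.card_ne_zero
  simp only [tohWeight, add_mul, mul_add, Finset.sum_add_distrib]
  by_cases h : y = z
  · simp [h, Finset.card_univ]
    field_simp
    ring
  · simp [h, Ne.symm h, Finset.card_univ]
    field_simp
    ring

open Classical in
lemma sum_tohMass_sq {G : Type*} [Group G] [Fintype G] [Nonempty G] (n : ℕ) (p : ℝ) :
    (Fintype.card G : ℝ) ^ Fintype.card {q : Fin n × Fin n // q.1 < q.2} *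
        ∑ Y, tohMass G n p Y ^ 2 =
      (1 / (Fintype.card G : ℝ)) ^ n * ∑ x : Fin n → G,
        ∏ q : {q : Fin n × Fin n // q.1 < q.2},
          (1 + p ^ 2 * (Fintype.card G * (if x q.1.1 = x q.1.2 then 1 else 0) - 1)) := by
  have hL : (Fintype.card G : ℝ) ≠ 0 := by exact_mod_cast Fintype.card_ne_zero
  set L := (Fintype.card G : ℝ) with hLdef
  set R := ∑ x : Fin n → G, ∏ q : {q : Fin n × Fin n // q.1 < q.2},
          (1 + p ^ 2 * (L * (if x q.1.1 = x q.1.2 then 1 else 0) - 1)) with hR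
  have h1 : ∀ g h : Fin n → G,
      L ^ Fintype.card {q : Fin n × Fin n // q.1 < q.2} *
        ∑ Y : {q : Fin n × Fin n // q.1 < q.2} → G,
          (∏ q, tohWeight p (h q.1.1 * (h q.1.2)⁻¹) (Y q)) *
            ∏ q, tohWeight p (g q.1.1 * (g q.1.2)⁻¹) (Y q) =
      ∏ q : {q : Fin n × Fin n // q.1 < q.2}, (1 + p ^ 2 *
        (L * (if h q.1.1 * (h q.1.2)⁻¹ = g q.1.1 * (g q.1.2)⁻¹ then 1 else 0) - 1)) := by
    intro g h
    simp_rw [hLdef, ← sum_tohWeight_mul, Finset.prod_mul_distrib, Finset.prod_const,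
      Finset.card_univ]
    rw [Finset.prod_univ_sum, Fintype.piFinset_univ]
    simp_rw [Finset.prod_mul_distrib]
  have h2 : ∀ h : Fin n → G, ∑ g : Fin n → G,
      ∏ q : {q : Fin n × Fin n // q.1 < q.2}, (1 + p ^ 2 *
        (L * (if h q.1.1 * (h q.1.2)⁻¹ = g q.1.1 * (g q.1.2)⁻¹ then 1 else 0) - 1)) = R := by
    intro h
    rw [hR, ← Equiv.sum_comp (Equiv.mulLeft h)]
    refine Finset.sum_congr rfl fun x _ => Finset.prod_congr rfl fun q _ => ?_
    have : (h q.1.1 * (h q.1.2)⁻¹ = (Equiv.mulLeft h x) q.1.1 * ((Equiv.mulLeft h x) q.1.2)⁻¹) ↔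
        x q.1.1 = x q.1.2 := by
      simp only [Equiv.coe_mulLeft, Pi.mul_apply, mul_inv_rev]
      rw [show h q.1.1 * x q.1.1 * ((x q.1.2)⁻¹ * (h q.1.2)⁻¹) =
        h q.1.1 * (x q.1.1 * (x q.1.2)⁻¹) * (h q.1.2)⁻¹ by group, mul_left_inj,
        left_eq_mul, mul_inv_eq_one]
    simp only [this]
  have h3 : ∑ Y, tohMass G n p Y ^ 2 = (1 / L) ^ n * (1 / L) ^ n * ∑ h : Fin n → G,
      ∑ g : Fin n → G, ∑ Y : {q : Fin n × Fin n // q.1 < q.2} → G,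
          (∏ q, tohWeight p (h q.1.1 * (h q.1.2)⁻¹) (Y q)) *
            ∏ q, tohWeight p (g q.1.1 * (g q.1.2)⁻¹) (Y q) := by
    have h4 : ∀ Y, tohMass G n p Y ^ 2 = (1 / L) ^ n * (1 / L) ^ n * ∑ h : Fin n → G,
        ∑ g : Fin n → G,
          (∏ q : {q : Fin n × Fin n // q.1 < q.2}, tohWeight p (h q.1.1 * (h q.1.2)⁻¹) (Y q)) *
            ∏ q : {q : Fin n × Fin n // q.1 < q.2},
              tohWeight p (g q.1.1 * (g q.1.2)⁻¹) (Y q) := by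
      intro Y
      rw [tohMass, sq, mul_mul_mul_comm, Finset.sum_mul_sum]
    simp_rw [h4]
    rw [← Finset.mul_sum, Finset.sum_comm]
    congr 1
    refine Finset.sum_congr rfl fun h _ => ?_
    rw [Finset.sum_comm]
  rw [h3, mul_left_comm, Finset.mul_sum]
  have h5 : ∀ h : Fin n → G, L ^ Fintype.card {q : Fin n × Fin n // q.1 < q.2} *
      ∑ g : Fin n → G, ∑ Y : {q : Fin n × Fin n // q.1 < q.2} → G,
          (∏ q, tohWeight p (h q.1.1 * (h q.1.2)⁻¹) (Y q)) *
            ∏ q, tohWeight p (g q.1.1 * (g q.1.2)⁻¹) (Y q) = R := by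
    intro h
    rw [← h2 h, Finset.mul_sum]
    exact Finset.sum_congr rfl fun g _ => h1 g h
  rw [Finset.sum_congr rfl fun h _ => h5 h]
  simp [← hLdef]
  field_simp

open Classical in
lemma sum_tohMass_sq_le {G : Type*} [Group G] [Fintype G] [Nonempty G] {c pt : ℝ}
    (hL : 3 ≤ Fintype.card G)
    (hc : c = ((Fintype.card G : ℝ) - 1) * Real.log ((Fintype.card G : ℝ) - 1) /
      ((Fintype.card G : ℝ) * ((Fintype.card G : ℝ) - 2)))
    (hpt : pt ^ 2 / 2 < c) {n : ℕ} (hn : 0 < n) (hp0 : 0 ≤ pt / √n) (hp1 : pt / √n ≤ 1) :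
    (Fintype.card G : ℝ) ^ Fintype.card {q : Fin n × Fin n // q.1 < q.2} *
        ∑ Y, tohMass G n (pt / √n) Y ^ 2 ≤
      ∏ _a : G, ∫ z, Real.exp (pt ^ 2 / 2 / (2 * c) * z ^ 2)
        ∂(ProbabilityTheory.gaussianReal 0 1) := by
  set L := (Fintype.card G : ℝ) with hLdef
  have hL3 : 3 ≤ L := by rw [hLdef]; exact_mod_cast hL
  have hn0 : (0 : ℝ) < n := by exact_mod_cast hn
  rw [sum_tohMass_sq]
  refine le_trans ?_ (exp_sq_centered_count_le hL3 hLdef.symm hc (by positivity) hpt hn)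
  refine mul_le_mul_of_nonneg_left (Finset.sum_le_sum fun x _ => ?_) (by positivity)
  have hpsq : (pt / √n) ^ 2 = pt ^ 2 / n := by rw [div_pow, Real.sq_sqrt hn0.le]
  have hp2 : (pt / √n) ^ 2 ≤ 1 := pow_le_one₀ hp0 hp1
  have h1 : ∏ q : {q : Fin n × Fin n // q.1 < q.2},
          (1 + (pt / √n) ^ 2 * (L * (if x q.1.1 = x q.1.2 then 1 else 0) - 1)) ≤
      Real.exp (∑ q : {q : Fin n × Fin n // q.1 < q.2},
          (pt / √n) ^ 2 * (L * (if x q.1.1 = x q.1.2 then 1 else 0) - 1)) := by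
    rw [Real.exp_sum]
    refine Finset.prod_le_prod (fun q _ => ?_) fun q _ => ?_
    · have : 0 ≤ (pt / √n) ^ 2 := by positivity
      split_ifs <;> nlinarith
    · rw [add_comm]; exact Real.add_one_le_exp _
  refine h1.trans (Real.exp_le_exp.mpr ?_)
  set f : Fin n → Fin n → ℝ := fun u v => L * (if x u = x v then 1 else 0) - 1 with hf
  have h2 := sum_pairs_eq f (fun u v => by simp only [hf, eq_comm])
  rw [← sum_sq_centered_count (by linarith) hLdef.symm] at h2
  have h3 : 0 ≤ ∑ u, f u u := Finset.sum_nonneg fun u _ => by simp [hf]; linarith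
  rw [← Finset.mul_sum, hpsq]
  have h4 : 0 ≤ pt ^ 2 / n := by positivity
  have h5 : (∑ q : {q : Fin n × Fin n // q.1 < q.2},
      f q.1.1 q.1.2) ≤ (L * ∑ a, (∑ u, ((if x u = a then 1 else 0) - 1 / L)) ^ 2) / 2 := by
    rw [h2]
    linarith
  refine (mul_le_mul_of_nonneg_left h5 h4).trans (le_of_eq ?_)
  field_simp

/-- Contiguity in the truth-or-Haar model: for a finite group `G` of order `L ≥ 3` and
`0 ≤ p̃ < √(2(L-1) log(L-1) / (L(L-2)))`, the spiked truth-or-Haar sequence is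
contiguous to the unspiked one. -/
theorem stmt_18 {G : Type*} [Group G] [Fintype G] [Nonempty G] [MeasurableSpace G]
    (hL : 3 ≤ Fintype.card G) (pt : ℝ) (hpt0 : 0 ≤ pt)
    (hpt : pt < Real.sqrt (2 * ((Fintype.card G : ℝ) - 1) *
        Real.log ((Fintype.card G : ℝ) - 1) /
      ((Fintype.card G : ℝ) * ((Fintype.card G : ℝ) - 2)))) :
    Contiguous (fun n => tohSpiked G n pt) (fun n => tohUnspiked G n) := by
  classical
  intro A hA hQ
  obtain ⟨c, hc⟩ : ∃ c, c = ((Fintype.card G : ℝ) - 1) * Real.log ((Fintype.card G : ℝ) - 1) /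
      ((Fintype.card G : ℝ) * ((Fintype.card G : ℝ) - 2)) := ⟨_, rfl⟩
  have hlam : pt ^ 2 / 2 < c := by
    have h := (Real.lt_sqrt hpt0).mp hpt
    rw [mul_assoc, mul_div_assoc, ← hc] at h
    linarith
  set C := ∏ _a : G, ∫ z, Real.exp (pt ^ 2 / 2 / (2 * c) * z ^ 2)
        ∂(ProbabilityTheory.gaussianReal 0 1)
  have hLpos : (0 : ℝ) < Fintype.card G := by exact_mod_cast Fintype.card_pos
  have hlim : Tendsto (fun n => ENNReal.ofReal √((tohUnspiked G n (A n)).toReal * C)) atTop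
      (𝓝 0) := by
    have h1 : Tendsto (fun n => (tohUnspiked G n (A n)).toReal) atTop (𝓝 0) := by
      exact (ENNReal.tendsto_toReal ENNReal.zero_ne_top).comp hQ
    have h2 := ENNReal.tendsto_ofReal ((h1.mul_const C).sqrt)
    simpa using h2
  refine tendsto_of_tendsto_of_tendsto_of_le_of_le' tendsto_const_nhds hlim
    (Eventually.of_forall fun _ => zero_le) ?_
  filter_upwards [eventually_gt_atTop 0, eventually_ge_atTop ⌈pt ^ 2⌉₊] with n hn hnp
  have hp0 : 0 ≤ pt / √n := by positivity
  have hp1 : pt / √n ≤ 1 := by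
    rw [div_le_one (by positivity)]
    exact Real.le_sqrt_of_sq_le ((Nat.le_ceil _).trans (by exact_mod_cast hnp))
  refine (tohSpiked_apply_le hp0 hp1 (hA n)).trans (ENNReal.ofReal_le_ofReal ?_)
  apply Real.le_sqrt_of_sq_le
  refine sq_sum_le_card_mul_sum_sq.trans ?_
  rw [tohUnspiked_apply (hA n), mul_assoc]
  refine mul_le_mul_of_nonneg_left ?_ (by positivity)
  have h1 := sum_tohMass_sq_le hL hc hlam hn hp0 hp1
  have h2 : ∑ Y with Y ∈ A n, tohMass G n (pt / √n) Y ^ 2 ≤ ∑ Y, tohMass G n (pt / √n) Y ^ 2 :=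
    Finset.sum_le_sum_of_subset_of_nonneg (Finset.filter_subset _ _) fun _ _ _ => sq_nonneg _
  refine h2.trans ?_
  rw [one_div, inv_pow, ← div_eq_inv_mul, le_div_iff₀ (by positivity), mul_comm]
  exact h1
end
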